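/- arXiv:2312.11132 — 5 statements merged into one kernel-verified Lean document; each statement's English description precedes it below -/
import Mathlib

section
/- Let R : ℝ^d → ℝ be an asset exposure risk measure, let β be a real d×m matrix of full rank m with 1 ≤ m < d, and define S(w) = inf{ R(y) : βᵀy = w }. Then for every w ∈ ℝ^m the infimum is attained at a unique point y*(w) ∈ ℝ^d (i.e., βᵀy*(w) = w and R(y*(w)) = S(w), and any other feasible y with R(y) = S(w) equals y*(w)); moreover S(w) > 0 for every w ≠ 0. -/
noncomputable section

open Matrix

/-- An asset exposure risk measure on `ℝ^d`: continuous, C¹ away from 0,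
positively homogeneous, subadditive, positive on nonzero vectors, and
additive only under scaled exposures. -/
structure IsAssetRiskMeasure {d : ℕ} (R : (Fin d → ℝ) → ℝ) : Prop where
  continuous : Continuous R
  contDiffAt : ∀ y : Fin d → ℝ, y ≠ 0 → ContDiffAt ℝ 1 R y
  pos_hom : ∀ l : ℝ, 0 ≤ l → ∀ y, R (l • y) = l * R y
  subadd : ∀ y₁ y₂, R (y₁ + y₂) ≤ R y₁ + R y₂
  pos : ∀ y, y ≠ 0 → 0 < R y
  add_eq : ∀ y₁ y₂, y₁ ≠ 0 → y₂ ≠ 0 →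
    R (y₁ + y₂) = R y₁ + R y₂ → ∃ c : ℝ, 0 < c ∧ y₁ = c • y₂

namespace IsAssetRiskMeasure

variable {d : ℕ} {R : (Fin d → ℝ) → ℝ}

theorem map_zero (hR : IsAssetRiskMeasure R) : R 0 = 0 := by
  simpa using hR.pos_hom 0 le_rfl 0

theorem nonneg (hR : IsAssetRiskMeasure R) (y : Fin d → ℝ) : 0 ≤ R y := by
  rcases eq_or_ne y 0 with rfl | hy
  · exact hR.map_zero.ge
  · exact (hR.pos y hy).le

theorem eq_zero_iff (hR : IsAssetRiskMeasure R) {y : Fin d → ℝ} : R y = 0 ↔ y = 0 :=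
  ⟨fun h => by_contra fun hy => (hR.pos y hy).ne' h, fun h => h ▸ hR.map_zero⟩

/-- A risk measure dominates a positive multiple of the norm. -/
theorem exists_pos_mul_norm_le (hR : IsAssetRiskMeasure R) :
    ∃ c : ℝ, 0 < c ∧ ∀ y, c * ‖y‖ ≤ R y := by
  rcases (Metric.sphere (0 : Fin d → ℝ) 1).eq_empty_or_nonempty with he | hne
  · refine ⟨1, one_pos, fun y => ?_⟩
    have hy : y = 0 := by
      by_contra hy
      have : ‖y‖⁻¹ • y ∈ Metric.sphere (0 : Fin d → ℝ) 1 := by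
        simp [norm_smul, norm_ne_zero_iff.mpr hy]
      simp [he] at this
    simp [hy, hR.map_zero]
  · obtain ⟨x, hx, hmin⟩ := (isCompact_sphere (0 : Fin d → ℝ) 1).exists_isMinOn hne
      hR.continuous.continuousOn
    have hx0 : x ≠ 0 := by
      rintro rfl
      simp at hx
    refine ⟨R x, hR.pos x hx0, fun y => ?_⟩
    rcases eq_or_ne y 0 with rfl | hy
    · simp [hR.map_zero]
    have hn : 0 < ‖y‖ := norm_pos_iff.mpr hy
    have hle : R x ≤ R (‖y‖⁻¹ • y) := hmin (by simp [norm_smul, hn.ne'])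
    rwa [hR.pos_hom _ (inv_nonneg.mpr hn.le), inv_mul_eq_div, le_div_iff₀ hn] at hle

theorem tendsto_cocompact_atTop (hR : IsAssetRiskMeasure R) :
    Filter.Tendsto R (Filter.cocompact _) Filter.atTop := by
  obtain ⟨c, hc, hle⟩ := hR.exists_pos_mul_norm_le
  exact Filter.tendsto_atTop_mono hle ((tendsto_norm_cocompact_atTop).const_mul_atTop hc)

theorem exists_isMinOn (hR : IsAssetRiskMeasure R) {s : Set (Fin d → ℝ)} (hs : IsClosed s)
    (hne : s.Nonempty) : ∃ y ∈ s, IsMinOn R s y := by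
  obtain ⟨x, hx⟩ := hne
  exact hR.continuous.continuousOn.exists_isMinOn' hs hx
    ((hR.tendsto_cocompact_atTop.eventually_ge_atTop (R x)).filter_mono inf_le_left)

theorem eq_of_isMinOn (hR : IsAssetRiskMeasure R) {s : Set (Fin d → ℝ)} (hs : Convex ℝ s)
    {x y : Fin d → ℝ} (hx : x ∈ s) (hy : y ∈ s) (hxmin : IsMinOn R s x)
    (hymin : IsMinOn R s y) : x = y := by
  have hxy : R x = R y := le_antisymm (hxmin hy) (hymin hx)
  rcases eq_or_ne x 0 with rfl | hx0
  · exact (hR.eq_zero_iff.mp (hxy ▸ hR.map_zero)).symm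
  rcases eq_or_ne y 0 with rfl | hy0
  · exact hR.eq_zero_iff.mp (hxy.trans hR.map_zero)
  have hmid : (1 / 2 : ℝ) • (x + y) ∈ s := by
    rw [smul_add]
    exact hs hx hy (by norm_num) (by norm_num) (by norm_num)
  have hle : R x ≤ R ((1 / 2 : ℝ) • (x + y)) := hxmin hmid
  rw [hR.pos_hom _ (by norm_num)] at hle
  obtain ⟨c, hc, h⟩ := hR.add_eq x y hx0 hy0
    (le_antisymm (hR.subadd x y) (by linarith))
  rw [h, hR.pos_hom c hc.le] at hxy
  rw [h, (mul_eq_right₀ (hR.pos y hy0).ne').mp hxy, one_smul]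

end IsAssetRiskMeasure

theorem Matrix.transpose_mulVec_surjective_of_rank_eq {d m : ℕ}
    {β : Matrix (Fin d) (Fin m) ℝ} (hβ : β.rank = m) :
    Function.Surjective fun y : Fin d → ℝ => βᵀ *ᵥ y := by
  have h : LinearMap.range βᵀ.mulVecLin = ⊤ := by
    apply Submodule.eq_top_of_finrank_eq
    rw [Module.finrank_fin_fun]
    exact (Matrix.rank_transpose β).trans hβ
  exact LinearMap.range_eq_top.mp h

/-- the infimum defining S(w) is attained at a unique point y*(w), and
S(w) > 0 whenever w ≠ 0. -/
theorem stmt_9 {d m : ℕ} (hm : 1 ≤ m) (hmd : m < d)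
    (R : (Fin d → ℝ) → ℝ) (hR : IsAssetRiskMeasure R)
    (β : Matrix (Fin d) (Fin m) ℝ) (hrank : β.rank = m)
    (S : (Fin m → ℝ) → ℝ)
    (hS : ∀ w, S w = sInf (R '' {y : Fin d → ℝ | βᵀ *ᵥ y = w})) :
    ∀ w : Fin m → ℝ,
      (∃! y : Fin d → ℝ, βᵀ *ᵥ y = w ∧ R y = S w) ∧ (w ≠ 0 → 0 < S w) := by
  intro w
  set s : Set (Fin d → ℝ) := {y | βᵀ *ᵥ y = w}
  have hclosed : IsClosed s :=
    isClosed_eq (Continuous.matrix_mulVec continuous_const continuous_id) continuous_const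
  have hconvex : Convex ℝ s := (convex_singleton w).linear_preimage βᵀ.mulVecLin
  obtain ⟨y, hy, hmin⟩ := hR.exists_isMinOn hclosed
    (Matrix.transpose_mulVec_surjective_of_rank_eq hrank w)
  have hSy : R y = S w := by
    rw [hS]
    exact (IsLeast.csInf_eq ⟨Set.mem_image_of_mem R hy, Set.forall_mem_image.mpr hmin⟩).symm
  refine ⟨⟨y, ⟨hy, hSy⟩, fun z hz => ?_⟩, fun hw => ?_⟩
  · refine hR.eq_of_isMinOn hconvex hz.1 hy (fun x hx => ?_) hmin
    simpa only [Set.mem_ofPred_eq, hz.2, ← hSy] using hmin hx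
  · rw [← hSy]
    refine hR.pos y ?_
    rintro rfl
    exact hw (hy.symm.trans (Matrix.mulVec_zero _))
end
end

section
/- Let R : ℝ^d → ℝ be an asset exposure risk measure, let b ∈ ℝ^d with b_i > 0 for all i and Σ_i b_i = 1, and let g : ℝ₊ → ℝ be continuously differentiable, convex and (strictly) increasing. Define Γ_g : (0,∞)^d → ℝ by Γ_g(y) = g(R(y)) − Σ_{i=1}^d b_i·log(y_i). Then Γ_g has a unique global minimizer y* on (0,∞)^d. -/
noncomputable section

open Matrix

theorem IsAssetRiskMeasure.exists_pos_mul_norm_le_s13 {d : ℕ} {R : (Fin d → ℝ) → ℝ}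
    (hR : IsAssetRiskMeasure R) : ∃ c : ℝ, 0 < c ∧ ∀ y, c * ‖y‖ ≤ R y := by
  obtain ⟨c, hc, h⟩ := (isCompact_sphere (0 : Fin d → ℝ) 1).exists_forall_le'
    hR.continuous.continuousOn (a := 0) (fun y hy => hR.pos y (by
      rintro rfl
      simp at hy))
  refine ⟨c, hc, fun y => ?_⟩
  rcases eq_or_ne y 0 with rfl | hy
  · have := hR.pos_hom 0 le_rfl 0
    simp at this
    simp [this]
  · have hn : 0 < ‖y‖ := norm_pos_iff.2 hy
    have h1 := h (‖y‖⁻¹ • y) (by simp [norm_smul, hn.ne'])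
    rw [hR.pos_hom _ (by positivity)] at h1
    calc c * ‖y‖ ≤ (‖y‖⁻¹ * R y) * ‖y‖ := by gcongr
      _ = R y := by field_simp

theorem IsAssetRiskMeasure.nonneg_s13 {d : ℕ} {R : (Fin d → ℝ) → ℝ}
    (hR : IsAssetRiskMeasure R) (y : Fin d → ℝ) : 0 ≤ R y := by
  obtain ⟨c, hc, h⟩ := hR.exists_pos_mul_norm_le_s13
  exact le_trans (by positivity) (h y)

theorem IsAssetRiskMeasure.convexOn {d : ℕ} {R : (Fin d → ℝ) → ℝ}
    (hR : IsAssetRiskMeasure R) : ConvexOn ℝ Set.univ R := by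
  refine ⟨convex_univ, fun x _ y _ s t hs ht _ => ?_⟩
  simpa [hR.pos_hom _ hs, hR.pos_hom _ ht] using hR.subadd (s • x) (t • y)

/-- A strictly increasing convex function on the half-line grows at least linearly. -/
theorem ConvexOn.add_mul_sub_one_le {g : ℝ → ℝ} (hg : ConvexOn ℝ (Set.Ici 0) g)
    (hmono : StrictMonoOn g (Set.Ici 0)) {t : ℝ} (ht : 0 ≤ t) :
    g 0 + (g 1 - g 0) * (t - 1) ≤ g t := by
  have h01 : g 0 < g 1 := hmono (by simp) (by simp) one_pos
  rcases le_or_gt t 1 with h | h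
  · have : g 0 ≤ g t := hmono.monotoneOn (by simp) ht ht
    nlinarith
  · have h2 := hg.2 (Set.self_mem_Ici (a := (0 : ℝ))) ht
      (sub_nonneg.2 (inv_le_one_of_one_le₀ h.le)) (inv_nonneg.2 ht) (sub_add_cancel 1 t⁻¹)
    have ht0 : t ≠ 0 := by positivity
    simp only [smul_eq_mul, mul_zero, zero_add, inv_mul_cancel₀ ht0] at h2
    have h3 := mul_le_mul_of_nonneg_left h2 ht
    have h4 : t * ((1 - t⁻¹) * g 0 + t⁻¹ * g t) = (t - 1) * g 0 + g t := by
      field_simp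
    nlinarith

theorem Real.one_add_log_le_mul_sub_log {K x : ℝ} (hK : 0 < K) (hx : 0 < x) :
    1 + Real.log K ≤ K * x - Real.log x := by
  have := Real.log_le_sub_one_of_pos (mul_pos hK hx)
  rw [Real.log_mul hK.ne' hx.ne'] at this
  linarith

/-- Sublevel sets of `x ↦ K * x - log x` on `(0, ∞)` are bounded away from `0` and `∞`. -/
theorem Real.mem_Icc_of_mul_sub_log_le {K x B : ℝ} (hK : 0 < K) (hx : 0 < x)
    (h : K * x - Real.log x ≤ B) :
    x ∈ Set.Icc (Real.exp (-B)) ((B - 1 - Real.log (K / 2)) / (K / 2)) := by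
  constructor
  · rw [← Real.le_log_iff_exp_le hx]
    nlinarith [mul_pos hK hx]
  · rw [le_div_iff₀ (by positivity)]
    have := Real.one_add_log_le_mul_sub_log (half_pos hK) hx
    linarith

theorem strictConvexOn_risk_sub_sum_log {d : ℕ} {R : (Fin d → ℝ) → ℝ}
    (hR : IsAssetRiskMeasure R) {b : Fin d → ℝ} (hb : ∀ i, 0 < b i) {g : ℝ → ℝ}
    (hg2 : ConvexOn ℝ (Set.Ici 0) g) (hg3 : StrictMonoOn g (Set.Ici 0)) :
    StrictConvexOn ℝ {y : Fin d → ℝ | ∀ i, 0 < y i}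
      (fun y => g (R y) - ∑ i, b i * Real.log (y i)) := by
  have hlog := strictConcaveOn_log_Ioi
  refine ⟨fun x hx y hy s t hs ht hst i => hlog.1 (hx i) (hy i) hs ht hst, ?_⟩
  intro x hx y hy hxy s t hs ht hst
  have h1 : g (R (s • x + t • y)) ≤ s * g (R x) + t * g (R y) :=
    (hg3.monotoneOn (hR.nonneg_s13 _)
      (hg2.1 (hR.nonneg_s13 x) (hR.nonneg_s13 y) hs.le ht.le hst)
      (hR.convexOn.2 trivial trivial hs.le ht.le hst)).trans
      (hg2.2 (hR.nonneg_s13 x) (hR.nonneg_s13 y) hs.le ht.le hst)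
  obtain ⟨j, hj⟩ := Function.ne_iff.1 hxy
  have h2 : ∑ i, b i * (s * Real.log (x i) + t * Real.log (y i)) <
      ∑ i, b i * Real.log ((s • x + t • y) i) := by
    refine Finset.sum_lt_sum (fun i _ => mul_le_mul_of_nonneg_left
      (hlog.concaveOn.2 (hx i) (hy i) hs.le ht.le hst) (hb i).le)
      ⟨j, Finset.mem_univ j, mul_lt_mul_of_pos_left
        (hlog.2 (hx j) (hy j) hj hs ht hst) (hb j)⟩
  have h3 : ∑ i, b i * (s * Real.log (x i) + t * Real.log (y i)) =
      s * ∑ i, b i * Real.log (x i) + t * ∑ i, b i * Real.log (y i) := by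
    rw [Finset.mul_sum, Finset.mul_sum, ← Finset.sum_add_distrib]
    exact Finset.sum_congr rfl fun i _ => by ring
  simp only [smul_eq_mul]
  linarith

theorem exists_add_sum_mul_sub_log_le {d : ℕ} {R : (Fin d → ℝ) → ℝ}
    (hR : IsAssetRiskMeasure R) {b : Fin d → ℝ} (hb : ∀ i, 0 < b i) (hb1 : ∑ i, b i = 1)
    {g : ℝ → ℝ} (hg2 : ConvexOn ℝ (Set.Ici 0) g) (hg3 : StrictMonoOn g (Set.Ici 0)) :
    ∃ C K : ℝ, 0 < K ∧ ∀ y : Fin d → ℝ,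
      C + ∑ i, b i * (K * y i - Real.log (y i)) ≤ g (R y) - ∑ i, b i * Real.log (y i) := by
  obtain ⟨c, hc, h⟩ := hR.exists_pos_mul_norm_le_s13
  have h01 : 0 < g 1 - g 0 := sub_pos.2 (hg3 (by simp) (by simp) one_pos)
  refine ⟨g 0 - (g 1 - g 0), (g 1 - g 0) * c, by positivity, fun y => ?_⟩
  have h1 : ∑ i, b i * y i ≤ ‖y‖ := by
    calc ∑ i, b i * y i ≤ ∑ i, b i * ‖y‖ := Finset.sum_le_sum fun i _ =>
          mul_le_mul_of_nonneg_left ((le_abs_self _).trans (norm_le_pi_norm y i)) (hb i).le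
      _ = ‖y‖ := by rw [← Finset.sum_mul, hb1, one_mul]
  have h2 := hg2.add_mul_sub_one_le hg3 (hR.nonneg_s13 y)
  have h3 : (g 1 - g 0) * (c * ∑ i, b i * y i) ≤ (g 1 - g 0) * R y := by
    have := h y
    gcongr
    nlinarith
  have h4 : ∑ i, b i * ((g 1 - g 0) * c * y i - Real.log (y i)) =
      (g 1 - g 0) * (c * ∑ i, b i * y i) - ∑ i, b i * Real.log (y i) := by
    rw [Finset.mul_sum, Finset.mul_sum, ← Finset.sum_sub_distrib]
    exact Finset.sum_congr rfl fun i _ => by ring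
  linarith

/-- Sublevel sets are contained in a compact box of positive vectors. -/
theorem exists_pos_sublevel_subset_Icc {d : ℕ} {R : (Fin d → ℝ) → ℝ}
    (hR : IsAssetRiskMeasure R) {b : Fin d → ℝ} (hb : ∀ i, 0 < b i) (hb1 : ∑ i, b i = 1)
    {g : ℝ → ℝ} (hg2 : ConvexOn ℝ (Set.Ici 0) g) (hg3 : StrictMonoOn g (Set.Ici 0)) (A : ℝ) :
    ∃ l u : Fin d → ℝ, (∀ i, 0 < l i) ∧ ∀ y : Fin d → ℝ, (∀ i, 0 < y i) →
      g (R y) - ∑ i, b i * Real.log (y i) ≤ A → y ∈ Set.Icc l u := by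
  obtain ⟨C, K, hK, h⟩ := exists_add_sum_mul_sub_log_le hR hb hb1 hg2 hg3
  let B : Fin d → ℝ := fun i => (A - C - (1 + Real.log K)) / b i + (1 + Real.log K)
  refine ⟨fun i => Real.exp (-B i), fun i => (B i - 1 - Real.log (K / 2)) / (K / 2),
    fun i => Real.exp_pos _, fun y hy hA => ?_⟩
  have key : ∀ i, K * y i - Real.log (y i) ≤ B i := by
    intro i
    have h1 : b i * (K * y i - Real.log (y i) - (1 + Real.log K)) ≤
        ∑ j, b j * (K * y j - Real.log (y j) - (1 + Real.log K)) :=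
      Finset.single_le_sum (f := fun j => b j * (K * y j - Real.log (y j) - (1 + Real.log K)))
        (fun j _ => mul_nonneg (hb j).le
          (sub_nonneg.2 (Real.one_add_log_le_mul_sub_log hK (hy j)))) (Finset.mem_univ i)
    have h2 : ∑ j, b j * (K * y j - Real.log (y j) - (1 + Real.log K)) =
        ∑ j, b j * (K * y j - Real.log (y j)) - (1 + Real.log K) := by
      simp only [mul_sub _ _ (1 + Real.log K), Finset.sum_sub_distrib, ← Finset.sum_mul, hb1,
        one_mul]
    have h3 := h y
    rw [← sub_le_iff_le_add, le_div_iff₀ (hb i)]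
    linarith
  have hbox i := Real.mem_Icc_of_mul_sub_log_le hK (hy i) (key i)
  exact ⟨fun i => (hbox i).1, fun i => (hbox i).2⟩

/-- for risk budgets b and g continuously differentiable, convex and
strictly increasing on ℝ₊, the function Γ_g(y) = g(R(y)) − Σᵢ bᵢ log yᵢ has a unique
global minimizer on (0,∞)^d. -/
theorem stmt_13 {d : ℕ} (R : (Fin d → ℝ) → ℝ) (hR : IsAssetRiskMeasure R)
    (b : Fin d → ℝ) (hb : ∀ i, 0 < b i) (hb1 : ∑ i, b i = 1)
    (g : ℝ → ℝ) (hg1 : ContDiffOn ℝ 1 g (Set.Ici 0))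
    (hg2 : ConvexOn ℝ (Set.Ici 0) g) (hg3 : StrictMonoOn g (Set.Ici 0)) :
    ∃! y : Fin d → ℝ, (∀ i, 0 < y i) ∧
      ∀ z : Fin d → ℝ, (∀ i, 0 < z i) →
        g (R y) - ∑ i, b i * Real.log (y i) ≤ g (R z) - ∑ i, b i * Real.log (z i) := by
  obtain ⟨l, u, hl, hlu⟩ := exists_pos_sublevel_subset_Icc hR hb hb1 hg2 hg3
    (g (R 1) - ∑ i, b i * Real.log ((1 : Fin d → ℝ) i))
  have h1 : (1 : Fin d → ℝ) ∈ Set.Icc l u := hlu 1 (fun _ => one_pos) le_rfl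
  have hcont : ContinuousOn (fun y : Fin d → ℝ => g (R y) - ∑ i, b i * Real.log (y i))
      (Set.Icc l u) := by
    refine ContinuousOn.sub ?_ (continuousOn_finsetSum _ fun i _ =>
      continuousOn_const.mul (ContinuousOn.log (continuous_apply i).continuousOn
        fun y hy => ((hl i).trans_le (hy.1 i)).ne'))
    exact hg1.continuousOn.comp hR.continuous.continuousOn fun y _ => hR.nonneg_s13 y
  obtain ⟨y, hy, hmin⟩ := isCompact_Icc.exists_isMinOn ⟨1, h1⟩ hcont
  have hypos : ∀ i, 0 < y i := fun i => (hl i).trans_le (hy.1 i)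
  have hglobal : ∀ z : Fin d → ℝ, (∀ i, 0 < z i) →
      g (R y) - ∑ i, b i * Real.log (y i) ≤ g (R z) - ∑ i, b i * Real.log (z i) := by
    intro z hz
    rcases le_total (g (R z) - ∑ i, b i * Real.log (z i))
      (g (R 1) - ∑ i, b i * Real.log ((1 : Fin d → ℝ) i)) with h | h
    · exact hmin (hlu z hz h)
    · exact (hmin h1).trans h
  refine ⟨y, ⟨hypos, hglobal⟩, fun z ⟨hz, hzmin⟩ => ?_⟩
  exact (strictConvexOn_risk_sub_sum_log hR hb hg2 hg3).eq_of_isMinOn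
    (fun w hw => hzmin w hw) (fun w hw => hglobal w hw) hz hypos
end
end

section
/- Let R : ℝ^d → ℝ be an asset exposure risk measure, b ∈ Δ^{>0}_d a vector of risk budgets, g : ℝ₊ → ℝ continuously differentiable, convex and strictly increasing, and let y* be the unique minimizer on (0,∞)^d of Γ_g(y) = g(R(y)) − Σ_{i=1}^d b_i·log(y_i). Then θ = y*/(Σ_{i=1}^d y*_i) lies in Δ^{>0}_d and solves the Risk Budgeting problem RB_b: θ_i·∂_iR(θ) = b_i·R(θ) for every i ∈ {1,…,d}. -/
noncomputable section

open Matrix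

/-- Euler's identity for positively homogeneous functions. -/
theorem fderiv_apply_self_of_pos_hom {E : Type*} [NormedAddCommGroup E] [NormedSpace ℝ E]
    {f : E → ℝ} (hom : ∀ l : ℝ, 0 ≤ l → ∀ y, f (l • y) = l * f y) {x : E}
    (hf : DifferentiableAt ℝ f x) : fderiv ℝ f x x = f x := by
  have hline : HasDerivAt (fun t : ℝ => t • x) x 1 := by
    simpa using (hasDerivAt_id (1 : ℝ)).smul_const x
  have hchain : HasDerivAt (fun t : ℝ => f (t • x)) (fderiv ℝ f x x) 1 := by
    have hfx : HasFDerivAt f (fderiv ℝ f x) ((1 : ℝ) • x) := by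
      simpa using hf.hasFDerivAt
    exact hfx.comp_hasDerivAt 1 hline
  have hlin : HasDerivAt (fun t : ℝ => t * f x) (f x) 1 := by
    simpa using (hasDerivAt_id (1 : ℝ)).mul_const (f x)
  refine hchain.unique (hlin.congr_of_eventuallyEq ?_)
  filter_upwards [eventually_gt_nhds (zero_lt_one' ℝ)] with t ht
  exact hom t ht.le x

/-- A positively homogeneous function of degree one has a derivative that is invariant under
positive scaling. -/
theorem fderiv_smul_of_pos_hom {E : Type*} [NormedAddCommGroup E] [NormedSpace ℝ E]
    {f : E → ℝ} (hom : ∀ l : ℝ, 0 ≤ l → ∀ y, f (l • y) = l * f y) {x : E}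
    (hf : DifferentiableAt ℝ f x) {c : ℝ} (hc : 0 < c) :
    fderiv ℝ f (c • x) = fderiv ℝ f x := by
  have hfx : HasFDerivAt f (fderiv ℝ f x) (c⁻¹ • c • x) := by
    simpa [inv_smul_smul₀ hc.ne'] using hf.hasFDerivAt
  have hscale := (hfx.comp (c • x) ((hasFDerivAt_id (c • x)).const_smul c⁻¹)).const_mul c
  have heq : (fun y => c * (f ∘ HSMul.hSMul c⁻¹) y) = f := by
    ext y
    simp [← hom c hc.le, smul_inv_smul₀ hc.ne']
  rw [heq] at hscale
  rw [hscale.fderiv]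
  ext v
  simp [mul_inv_cancel_left₀ hc.ne']

/-- First-order condition for a minimizer of `g ∘ R - ∑ i, b i * log (y i)` on the open positive
orthant. -/
theorem mul_fderiv_single_eq_of_isMinOn_log_barrier {ι : Type*} [Fintype ι] [DecidableEq ι]
    {R : (ι → ℝ) → ℝ} {b y : ι → ℝ} {g : ℝ → ℝ} (hy : ∀ i, 0 < y i)
    (hR : DifferentiableAt ℝ R y) (hg : DifferentiableAt ℝ g (R y))
    (hmin : IsMinOn (fun z => g (R z) - ∑ i, b i * Real.log (z i)) {z | ∀ i, 0 < z i} y)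
    (i : ι) : y i * (deriv g (R y) * fderiv ℝ R y (Pi.single i 1)) = b i := by
  have hopen : IsOpen {z : ι → ℝ | ∀ i, 0 < z i} := by
    simp only [Set.ofPred_forall]
    exact isOpen_iInter_of_finite fun j => isOpen_lt continuous_const (continuous_apply j)
  have hlog : HasFDerivAt (fun z : ι → ℝ => ∑ j, b j * Real.log (z j))
      (∑ j, b j • (y j)⁻¹ • ContinuousLinearMap.proj (R := ℝ) (φ := fun _ : ι => ℝ) j) y :=
    HasFDerivAt.fun_sum fun j _ =>
      ((hasFDerivAt_apply (𝕜 := ℝ) j y).log (hy j).ne').const_mul (b j)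
  have hzero := (hmin.isLocalMin (hopen.mem_nhds hy)).hasFDerivAt_eq_zero
    ((hg.hasDerivAt.comp_hasFDerivAt y hR.hasFDerivAt).sub hlog)
  have happ := congrArg (fun L => L (Pi.single i 1)) hzero
  simp [Pi.single_apply] at happ
  have := (hy i).ne'
  rw [sub_eq_zero.mp happ]
  field_simp

/-- normalizing the minimizer y* of Γ_g yields a strictly long-only
portfolio θ ∈ Δ^{>0}_d solving the Risk Budgeting problem RB_b:
θᵢ ∂ᵢR(θ) = bᵢ R(θ) for every i. -/
theorem stmt_14 {d : ℕ} (R : (Fin d → ℝ) → ℝ) (hR : IsAssetRiskMeasure R)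
    (b : Fin d → ℝ) (hb : ∀ i, 0 < b i) (hb1 : ∑ i, b i = 1)
    (g : ℝ → ℝ) (hg1 : ContDiffOn ℝ 1 g (Set.Ici 0))
    (hg2 : ConvexOn ℝ (Set.Ici 0) g) (hg3 : StrictMonoOn g (Set.Ici 0))
    (ystar : Fin d → ℝ) (hpos : ∀ i, 0 < ystar i)
    (hmin : ∀ z : Fin d → ℝ, (∀ i, 0 < z i) →
      g (R ystar) - ∑ i, b i * Real.log (ystar i) ≤ g (R z) - ∑ i, b i * Real.log (z i))
    (huniq : ∀ y : Fin d → ℝ, (∀ i, 0 < y i) →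
      (∀ z : Fin d → ℝ, (∀ i, 0 < z i) →
        g (R y) - ∑ i, b i * Real.log (y i) ≤ g (R z) - ∑ i, b i * Real.log (z i)) →
      y = ystar) :
    ∀ θ : Fin d → ℝ, θ = (∑ j, ystar j)⁻¹ • ystar →
      (∀ i, 0 < θ i) ∧ (∑ i, θ i = 1) ∧
        ∀ i, θ i * fderiv ℝ R θ (Pi.single i 1) = b i * R θ := by
  rintro θ rfl
  obtain ⟨k⟩ : Nonempty (Fin d) := by
    by_contra h
    rw [not_nonempty_iff] at h
    simp at hb1
  have hy0 : ystar ≠ 0 := fun h => (hpos k).ne' (congrFun h k)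
  have hsum : 0 < ∑ j, ystar j := Finset.sum_pos (fun j _ => hpos j) ⟨k, Finset.mem_univ k⟩
  have hRd : DifferentiableAt ℝ R ystar := (hR.contDiffAt ystar hy0).differentiableAt one_ne_zero
  have hRpos : 0 < R ystar := hR.pos ystar hy0
  have hgd : DifferentiableAt ℝ g (R ystar) :=
    (hg1.contDiffAt (Ici_mem_nhds hRpos)).differentiableAt one_ne_zero
  have hfoc := mul_fderiv_single_eq_of_isMinOn_log_barrier hpos hRd hgd
    (isMinOn_iff.mpr hmin)
  have heuler : ∑ i, ystar i * fderiv ℝ R ystar (Pi.single i 1) = R ystar := by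
    rw [← fderiv_apply_self_of_pos_hom hR.pos_hom hRd]
    conv_rhs => arg 2; rw [← Finset.univ_sum_single ystar]
    rw [map_sum]
    refine Finset.sum_congr rfl fun i _ => ?_
    rw [← smul_eq_mul, ← map_smul, ← Pi.single_smul, smul_eq_mul, mul_one]
  have hgR : deriv g (R ystar) * R ystar = 1 := by
    nth_rw 2 [← heuler]
    rw [Finset.mul_sum]
    refine (Finset.sum_congr rfl fun i _ => ?_).trans hb1
    rw [← hfoc i, mul_left_comm]
  refine ⟨fun i => mul_pos (inv_pos.mpr hsum) (hpos i), ?_, fun i => ?_⟩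
  · simp [← Finset.mul_sum, inv_mul_cancel₀ hsum.ne']
  · rw [fderiv_smul_of_pos_hom hR.pos_hom hRd (inv_pos.mpr hsum),
      hR.pos_hom _ (inv_pos.mpr hsum).le, ← hfoc i, Pi.smul_apply, smul_eq_mul]
    linear_combination -(∑ j, ystar j)⁻¹ * ystar i * fderiv ℝ R ystar (Pi.single i 1) * hgR
end
end

section
/- Let R : ℝ^d → ℝ be an asset exposure risk measure and b ∈ Δ^{>0}_d a vector of risk budgets. Then there is exactly one θ ∈ Δ^{>0}_d solving the Risk Budgeting problem RB_b, i.e. satisfying θ_i·∂_iR(θ) = b_i·R(θ) for every i ∈ {1,…,d}. -/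
noncomputable section

open Matrix

/-- The supporting hyperplane inequality for a sublinear function. -/
theorem fderiv_le_of_sublinear {E : Type*} [NormedAddCommGroup E] [NormedSpace ℝ E] {R : E → ℝ}
    (hom : ∀ l : ℝ, 0 ≤ l → ∀ y, R (l • y) = l * R y)
    (sub : ∀ y₁ y₂, R (y₁ + y₂) ≤ R y₁ + R y₂) {x : E} (hx : DifferentiableAt ℝ R x) (v : E) :
    fderiv ℝ R x v ≤ R v := by
  have h : HasDerivAt (fun t : ℝ => R (x + t • v)) (fderiv ℝ R x v) 0 := by
    exact hx.hasFDerivAt.hasLineDerivAt v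
  have hlim := (hasDerivAt_iff_tendsto_slope_zero.1 h).mono_left
    (nhdsWithin_mono 0 (show Set.Ioi (0 : ℝ) ⊆ {0}ᶜ from fun t ht => ne_of_gt ht))
  refine le_of_tendsto hlim ?_
  filter_upwards [self_mem_nhdsWithin] with t ht
  have ht : 0 < t := ht
  have h1 := sub x (t • v)
  rw [hom t ht.le] at h1
  simp only [zero_add, zero_smul, add_zero, smul_eq_mul]
  rw [inv_mul_le_iff₀ ht]
  linarith

/-- The logarithmic risk budgeting objective on the positive orthant. -/
def riskBudgetObjective {d : ℕ} (R : (Fin d → ℝ) → ℝ) (b y : Fin d → ℝ) : ℝ :=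
  ∑ i, b i * Real.log (y i) - Real.log (R y)

namespace IsAssetRiskMeasure

variable {d : ℕ} {R : (Fin d → ℝ) → ℝ} {b : Fin d → ℝ}

theorem differentiableAt (hR : IsAssetRiskMeasure R) {y : Fin d → ℝ} (hy : y ≠ 0) :
    DifferentiableAt ℝ R y :=
  (hR.contDiffAt y hy).differentiableAt one_ne_zero

theorem ne_zero_of_sum_eq_one {y : Fin d → ℝ} (hy : ∑ i, y i = 1) : y ≠ 0 := by
  rintro rfl
  simp at hy

theorem riskBudgetObjective_smul (hR : IsAssetRiskMeasure R) (hb1 : ∑ i, b i = 1)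
    {y : Fin d → ℝ} (hy : ∀ i, 0 < y i) (hy0 : y ≠ 0) {l : ℝ} (hl : 0 < l) :
    riskBudgetObjective R b (l • y) = riskBudgetObjective R b y := by
  have h (i) : Real.log ((l • y) i) = Real.log l + Real.log (y i) :=
    Real.log_mul hl.ne' (hy i).ne'
  simp only [riskBudgetObjective, h, hR.pos_hom l hl.le, Real.log_mul hl.ne' (hR.pos y hy0).ne',
    mul_add, Finset.sum_add_distrib, ← Finset.sum_mul, hb1]
  ring

theorem exists_isMax_simplex (hR : IsAssetRiskMeasure R) (hb : ∀ i, 0 < b i)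
    (hb1 : ∑ i, b i = 1) :
    ∃ θ : Fin d → ℝ, (∀ i, 0 < θ i) ∧ ∑ i, θ i = 1 ∧
      ∀ y : Fin d → ℝ, (∀ i, 0 < y i) → ∑ i, y i = 1 →
        riskBudgetObjective R b y ≤ riskBudgetObjective R b θ := by
  have hcont : ContinuousOn (fun y : Fin d → ℝ => (∏ i, y i ^ b i) / R y)
      (stdSimplex ℝ (Fin d)) := by
    refine ContinuousOn.div (Continuous.continuousOn ?_) hR.continuous.continuousOn
      fun y hy => (hR.pos y (ne_zero_of_sum_eq_one hy.2)).ne'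
    exact continuous_finsetProd _ fun i _ =>
      (continuous_apply i).rpow_const fun _ => Or.inr (hb i).le
  obtain ⟨θ, hθ, hmax⟩ := (isCompact_stdSimplex ℝ (Fin d)).exists_isMaxOn
    ⟨b, fun i => (hb i).le, hb1⟩ hcont
  have hpos (y : Fin d → ℝ) (hy : ∀ i, 0 < y i) (hy1 : ∑ i, y i = 1) :
      0 < (∏ i, y i ^ b i) / R y :=
    div_pos (Finset.prod_pos fun i _ => Real.rpow_pos_of_pos (hy i) _)
      (hR.pos y (ne_zero_of_sum_eq_one hy1))
  have hlog (y : Fin d → ℝ) (hy : ∀ i, 0 < y i) (hy1 : ∑ i, y i = 1) :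
      Real.log ((∏ i, y i ^ b i) / R y) = riskBudgetObjective R b y := by
    rw [Real.log_div (Finset.prod_pos fun i _ => Real.rpow_pos_of_pos (hy i) _).ne'
      (hR.pos y (ne_zero_of_sum_eq_one hy1)).ne',
      Real.log_prod fun i _ => (Real.rpow_pos_of_pos (hy i) _).ne']
    simp only [riskBudgetObjective, Real.log_rpow (hy _)]
  have hθpos (i) : 0 < θ i := by
    refine (hθ.1 i).lt_of_ne' fun h0 => ?_
    have hle : (∏ i, b i ^ b i) / R b ≤ (∏ i, θ i ^ b i) / R θ :=
      hmax ⟨fun i => (hb i).le, hb1⟩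
    have hzero : ∏ i, θ i ^ b i = 0 :=
      Finset.prod_eq_zero (Finset.mem_univ i) (by rw [h0, Real.zero_rpow (hb i).ne'])
    rw [hzero, zero_div] at hle
    exact (hpos b hb hb1).not_ge hle
  refine ⟨θ, hθpos, hθ.2, fun y hy hy1 => ?_⟩
  rw [← hlog y hy hy1, ← hlog θ hθpos hθ.2]
  exact Real.log_le_log (hpos y hy hy1) (hmax ⟨fun i => (hy i).le, hy1⟩)

theorem exists_riskBudget (hR : IsAssetRiskMeasure R) (hb : ∀ i, 0 < b i)
    (hb1 : ∑ i, b i = 1) :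
    ∃ θ : Fin d → ℝ, (∀ i, 0 < θ i) ∧ ∑ i, θ i = 1 ∧
      ∀ i, θ i * fderiv ℝ R θ (Pi.single i 1) = b i * R θ := by
  obtain ⟨θ, hθ, hθ1, hmax⟩ := hR.exists_isMax_simplex hb hb1
  have hθ0 := ne_zero_of_sum_eq_one hθ1
  have hRθ := hR.pos θ hθ0
  have hloc : IsLocalMax (riskBudgetObjective R b) θ := by
    have hev : ∀ᶠ y in nhds θ, ∀ i, 0 < y i :=
      Filter.eventually_all.2 fun i =>
        (continuous_apply i).continuousAt.eventually (lt_mem_nhds (hθ i))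
    have hne : (Finset.univ : Finset (Fin d)).Nonempty :=
      Finset.nonempty_of_sum_ne_zero (hθ1.trans_ne one_ne_zero)
    filter_upwards [hev] with y hy
    have hs : 0 < ∑ i, y i := Finset.sum_pos (fun i _ => hy i) hne
    have hy0 : y ≠ 0 := by
      rintro rfl
      simp at hs
    rw [← hR.riskBudgetObjective_smul hb1 hy hy0 (inv_pos.2 hs)]
    refine hmax _ (fun i => mul_pos (inv_pos.2 hs) (hy i)) ?_
    simp only [Pi.smul_apply, smul_eq_mul, ← Finset.mul_sum]
    exact inv_mul_cancel₀ hs.ne'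
  have hder : HasFDerivAt (riskBudgetObjective R b)
      (∑ i, b i • (θ i)⁻¹ • ContinuousLinearMap.proj (R := ℝ) (φ := fun _ : Fin d => ℝ) i -
        (R θ)⁻¹ • fderiv ℝ R θ) θ :=
    (HasFDerivAt.fun_sum fun i _ =>
      ((hasFDerivAt_apply i θ).log (hθ i).ne').const_mul (b i)).sub
      ((hR.differentiableAt hθ0).hasFDerivAt.log hRθ.ne')
  have hzero := hloc.hasFDerivAt_eq_zero hder
  refine ⟨θ, hθ, hθ1, fun i => ?_⟩
  have hi := DFunLike.congr_fun hzero (Pi.single i 1)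
  simp [Pi.single_apply] at hi
  have hi0 := (hθ i).ne'
  have hR0 := hRθ.ne'
  field_simp at hi
  linarith

theorem sum_mul_div_le (hR : IsAssetRiskMeasure R) {θ φ : Fin d → ℝ} (hθ : ∀ i, 0 < θ i)
    (hθ0 : θ ≠ 0) (h : ∀ i, θ i * fderiv ℝ R θ (Pi.single i 1) = b i * R θ) :
    R θ * ∑ i, b i * (φ i / θ i) ≤ R φ := by
  refine le_trans (le_of_eq ?_)
    (fderiv_le_of_sublinear hR.pos_hom hR.subadd (hR.differentiableAt hθ0) φ)
  conv_rhs => rw [← ContinuousLinearMap.coe_coe, LinearMap.pi_apply_eq_sum_univ _ φ]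
  rw [Finset.mul_sum]
  refine Finset.sum_congr rfl fun i _ => ?_
  have hsingle : (fun j => if i = j then (1 : ℝ) else 0) = Pi.single i 1 := by
    ext j
    simp [Pi.single_apply, eq_comm]
  rw [hsingle, ContinuousLinearMap.coe_coe, smul_eq_mul]
  have hi := h i
  have hi0 := (hθ i).ne'
  field_simp
  linear_combination -φ i * hi

theorem riskBudget_unique (hR : IsAssetRiskMeasure R) (hb : ∀ i, 0 < b i)
    (hb1 : ∑ i, b i = 1) {θ φ : Fin d → ℝ} (hθ : ∀ i, 0 < θ i) (hθ1 : ∑ i, θ i = 1)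
    (h : ∀ i, θ i * fderiv ℝ R θ (Pi.single i 1) = b i * R θ)
    (hφ : ∀ i, 0 < φ i) (hφ1 : ∑ i, φ i = 1)
    (h' : ∀ i, φ i * fderiv ℝ R φ (Pi.single i 1) = b i * R φ) : φ = θ := by
  have hθ0 := ne_zero_of_sum_eq_one hθ1
  have hφ0 := ne_zero_of_sum_eq_one hφ1
  have hRθ := hR.pos θ hθ0
  have hRφ := hR.pos φ hφ0
  have h1 := hR.sum_mul_div_le (φ := φ) hθ hθ0 h
  have h2 := hR.sum_mul_div_le (φ := θ) hφ hφ0 h'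
  rw [← le_div_iff₀' hRθ] at h1
  rw [← le_div_iff₀' hRφ] at h2
  obtain ⟨A, hA⟩ : ∃ A, A = R φ / R θ := ⟨_, rfl⟩
  have hApos : 0 < A := hA ▸ div_pos hRφ hRθ
  rw [← hA] at h1
  rw [← inv_div, ← hA] at h2
  have hterm (i) : b i * ((φ i - A * θ i) ^ 2 / (A * θ i * φ i)) =
      A⁻¹ * (b i * (φ i / θ i)) + A * (b i * (θ i / φ i)) - 2 * b i := by
    have := (hθ i).ne'
    have := (hφ i).ne'
    field_simp
    ring
  have hnonneg (i) : 0 ≤ b i * ((φ i - A * θ i) ^ 2 / (A * θ i * φ i)) := by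
    have := hb i
    have := hθ i
    have := hφ i
    positivity
  have hsum : ∑ i, b i * ((φ i - A * θ i) ^ 2 / (A * θ i * φ i)) ≤ 0 := by
    simp only [hterm, Finset.sum_sub_distrib, Finset.sum_add_distrib, ← Finset.mul_sum, hb1]
    have e1 := mul_le_mul_of_nonneg_left h1 (inv_pos.2 hApos).le
    have e2 := mul_le_mul_of_nonneg_left h2 hApos.le
    rw [inv_mul_cancel₀ hApos.ne'] at e1
    rw [mul_inv_cancel₀ hApos.ne'] at e2
    linarith
  have hall (i) : φ i = A * θ i := by
    have hi := (Finset.sum_eq_zero_iff_of_nonneg fun i _ => hnonneg i).1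
      (hsum.antisymm (Finset.sum_nonneg fun i _ => hnonneg i)) i (Finset.mem_univ i)
    have hden := (mul_pos (mul_pos hApos (hθ i)) (hφ i)).ne'
    have hsq := (div_eq_zero_iff.1 ((mul_eq_zero.1 hi).resolve_left (hb i).ne')).resolve_right hden
    exact sub_eq_zero.1 (pow_eq_zero_iff two_ne_zero |>.1 hsq)
  have hA1 : A = 1 := by
    simpa only [hall, ← Finset.mul_sum, hθ1, mul_one] using hφ1
  ext i
  rw [hall, hA1, one_mul]

end IsAssetRiskMeasure

/-- there is exactly one θ ∈ Δ^{>0}_d solving the Risk Budgeting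
problem RB_b. -/
theorem stmt_15 {d : ℕ} (R : (Fin d → ℝ) → ℝ) (hR : IsAssetRiskMeasure R)
    (b : Fin d → ℝ) (hb : ∀ i, 0 < b i) (hb1 : ∑ i, b i = 1) :
    ∃! θ : Fin d → ℝ, (∀ i, 0 < θ i) ∧ (∑ i, θ i = 1) ∧
      ∀ i, θ i * fderiv ℝ R θ (Pi.single i 1) = b i * R θ := by
  obtain ⟨θ, hθ, hθ1, h⟩ := hR.exists_riskBudget hb hb1
  exact ⟨θ, ⟨hθ, hθ1, h⟩, fun φ ⟨hφ, hφ1, h'⟩ =>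
    hR.riskBudget_unique hb hb1 hθ hθ1 h hφ hφ1 h'⟩
end
end

section
/- Let R : ℝ^d → ℝ be an asset exposure risk measure, β a real d×m matrix of full rank m with 1 ≤ m < d, S(w) = inf{ R(y) : βᵀy = w }, b ∈ Δ^{>0}_m, and g : ℝ₊ → ℝ continuously differentiable, convex and strictly increasing. Let w* be the unique minimizer on (0,∞)^m of Γ_g(w) = g(S(w)) − Σ_{i=1}^m b_i·log(w_i). If θ ∈ Δ_d solves the Factor Risk Budgeting problem FRB_b (i.e., w = βᵀθ has all coordinates strictly positive and w_i·∂_iS(w) = b_i·S(w) for all i ∈ {1,…,m}), then βᵀθ = c·w* for some c > 0. -/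
noncomputable section

open Matrix

open Filter Topology in
/-- The derivative of a sublinear function is a subgradient. -/
theorem fderiv_le_of_sublinear_s19 {E : Type*} [NormedAddCommGroup E] [NormedSpace ℝ E] {S : E → ℝ}
    (hsub : ∀ u v, S (u + v) ≤ S u + S v) (hhom : ∀ t : ℝ, 0 < t → ∀ v, S (t • v) ≤ t * S v)
    {w : E} (hd : DifferentiableAt ℝ S w) (v : E) : fderiv ℝ S w v ≤ S v := by
  have h := (hd.hasFDerivAt.hasLineDerivAt v).tendsto_slope_zero_right
  refine le_of_tendsto h ?_
  filter_upwards [self_mem_nhdsWithin] with t (ht : 0 < t)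
  rw [smul_eq_mul, inv_mul_le_iff₀ ht]
  linarith [hsub w (t • v), hhom t ht v]

theorem Matrix.mulVec_surjective_of_rank_eq {m d : ℕ} {A : Matrix (Fin m) (Fin d) ℝ}
    (h : A.rank = m) : Function.Surjective (A *ᵥ ·) := by
  have : LinearMap.range A.mulVecLin = ⊤ :=
    Submodule.eq_top_of_finrank_eq (by simpa [Matrix.rank] using h)
  exact LinearMap.range_eq_top.mp this

namespace IsAssetRiskMeasure

variable {d : ℕ} {R : (Fin d → ℝ) → ℝ}

theorem bddBelow_image (hR : IsAssetRiskMeasure R) (s : Set (Fin d → ℝ)) :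
    BddBelow (R '' s) :=
  ⟨0, by rintro _ ⟨y, -, rfl⟩; exact hR.nonneg y⟩

theorem exists_mul_norm_le (hR : IsAssetRiskMeasure R) : ∃ c, 0 < c ∧ ∀ y, c * ‖y‖ ≤ R y := by
  rcases (Metric.sphere (0 : Fin d → ℝ) 1).eq_empty_or_nonempty with he | hne
  · refine ⟨1, one_pos, fun y => ?_⟩
    rcases eq_or_ne y 0 with rfl | h
    · simp [hR.map_zero]
    · have : ‖y‖⁻¹ • y ∈ Metric.sphere (0 : Fin d → ℝ) 1 := by
        simp [norm_smul, h]
      simp [he] at this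
  · obtain ⟨x, hx, hmin⟩ := (isCompact_sphere (0 : Fin d → ℝ) 1).exists_isMinOn hne
      hR.continuous.continuousOn
    refine ⟨R x, hR.pos x (ne_zero_of_mem_unit_sphere ⟨x, hx⟩), fun y => ?_⟩
    rcases eq_or_ne y 0 with rfl | h
    · simp [hR.map_zero]
    · have hy : 0 < ‖y‖ := norm_pos_iff.mpr h
      have : R x ≤ R (‖y‖⁻¹ • y) := hmin (by simp [norm_smul, h])
      rw [hR.pos_hom _ (by positivity), le_inv_mul_iff₀ hy] at this
      linarith

end IsAssetRiskMeasure

section FactorRisk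

variable {d m : ℕ} {R : (Fin d → ℝ) → ℝ} {A : Matrix (Fin m) (Fin d) ℝ} {S : (Fin m → ℝ) → ℝ}

theorem factorRisk_smul_le (hR : IsAssetRiskMeasure R) (hA : Function.Surjective (A *ᵥ ·))
    (hS : ∀ w, S w = sInf (R '' {y | A *ᵥ y = w})) {t : ℝ} (ht : 0 < t) (w : Fin m → ℝ) :
    S (t • w) ≤ t * S w := by
  rw [← div_le_iff₀' ht, hS w]
  refine le_csInf (Set.Nonempty.image _ (hA w)) ?_
  rintro _ ⟨y, hy, rfl⟩
  rw [div_le_iff₀' ht, ← hR.pos_hom t ht.le, hS]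
  refine csInf_le (hR.bddBelow_image _) ⟨t • y, ?_, rfl⟩
  rw [Set.mem_ofPred_eq] at hy ⊢
  rw [Matrix.mulVec_smul, hy]

theorem factorRisk_add_le (hR : IsAssetRiskMeasure R) (hA : Function.Surjective (A *ᵥ ·))
    (hS : ∀ w, S w = sInf (R '' {y | A *ᵥ y = w})) (u v : Fin m → ℝ) :
    S (u + v) ≤ S u + S v := by
  rw [← sub_le_iff_le_add, hS u]
  refine le_csInf (Set.Nonempty.image _ (hA u)) ?_
  rintro _ ⟨x, hx, rfl⟩
  rw [sub_le_comm, hS v]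
  refine le_csInf (Set.Nonempty.image _ (hA v)) ?_
  rintro _ ⟨y, hy, rfl⟩
  rw [sub_le_iff_le_add']
  refine le_trans ?_ (hR.subadd x y)
  rw [hS]
  refine csInf_le (hR.bddBelow_image _) ⟨x + y, ?_, rfl⟩
  rw [Set.mem_ofPred_eq] at hx hy ⊢
  rw [Matrix.mulVec_add, hx, hy]

theorem factorRisk_nonneg (hR : IsAssetRiskMeasure R)
    (hS : ∀ w, S w = sInf (R '' {y | A *ᵥ y = w})) (w : Fin m → ℝ) : 0 ≤ S w := by
  rw [hS]
  exact Real.sInf_nonneg (by rintro _ ⟨y, -, rfl⟩; exact hR.nonneg y)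

theorem factorRisk_pos (hR : IsAssetRiskMeasure R) (hA : Function.Surjective (A *ᵥ ·))
    (hS : ∀ w, S w = sInf (R '' {y | A *ᵥ y = w})) {w : Fin m → ℝ} (hw : w ≠ 0) : 0 < S w := by
  obtain ⟨c, hc, hcR⟩ := hR.exists_mul_norm_le
  obtain ⟨C, hC, hCA⟩ := (LinearMap.toContinuousLinearMap A.mulVecLin).bound
  have hw' : 0 < ‖w‖ := norm_pos_iff.mpr hw
  have hpos : 0 < c * (‖w‖ / C) := by positivity
  refine hpos.trans_le ?_
  rw [hS]
  refine le_csInf (Set.Nonempty.image _ (hA w)) ?_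
  rintro _ ⟨y, rfl, rfl⟩
  refine le_trans ?_ (hcR y)
  gcongr
  exact (div_le_iff₀' hC).mpr (hCA y)

end FactorRisk

/-- The equality case of the weighted arithmetic-geometric mean inequality, in logarithmic form. -/
theorem eq_of_log_sum_le_sum_log {ι : Type*} [Fintype ι] {b x : ι → ℝ} (hb : ∀ i, 0 < b i)
    (hb1 : ∑ i, b i = 1) (hx : ∀ i, 0 < x i)
    (h : Real.log (∑ i, b i * x i) ≤ ∑ i, b i * Real.log (x i)) (i : ι) :
    x i = ∑ j, b j * x j :=
  (strictConcaveOn_log_Ioi.map_sum_eq_iff (fun i _ => hb i) hb1 (fun i _ => hx i)).mp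
    (le_antisymm h (strictConcaveOn_log_Ioi.concaveOn.le_map_sum (fun i _ => (hb i).le) hb1
      (fun i _ => hx i))) i (Finset.mem_univ i)

/-- if θ ∈ Δ_d solves the Factor Risk Budgeting problem FRB_b, then its
factor exposure βᵀθ is proportional (with positive factor) to the unique minimizer w*
of Γ_g on (0,∞)^m. -/
theorem stmt_19 {d m : ℕ} (hm : 1 ≤ m) (hmd : m < d)
    (R : (Fin d → ℝ) → ℝ) (hR : IsAssetRiskMeasure R)
    (β : Matrix (Fin d) (Fin m) ℝ) (hrank : β.rank = m)
    (S : (Fin m → ℝ) → ℝ)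
    (hS : ∀ w, S w = sInf (R '' {y : Fin d → ℝ | βᵀ *ᵥ y = w}))
    (b : Fin m → ℝ) (hb : ∀ i, 0 < b i) (hb1 : ∑ i, b i = 1)
    (g : ℝ → ℝ) (hg1 : ContDiffOn ℝ 1 g (Set.Ici 0))
    (hg2 : ConvexOn ℝ (Set.Ici 0) g) (hg3 : StrictMonoOn g (Set.Ici 0))
    (wstar : Fin m → ℝ) (hwpos : ∀ i, 0 < wstar i)
    (hwmin : ∀ v : Fin m → ℝ, (∀ i, 0 < v i) →
      g (S wstar) - ∑ i, b i * Real.log (wstar i) ≤ g (S v) - ∑ i, b i * Real.log (v i))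
    (θ : Fin d → ℝ) (hθ : ∑ i, θ i = 1)
    (hθw : ∀ i, 0 < (βᵀ *ᵥ θ) i)
    (hFRB : ∀ i, (βᵀ *ᵥ θ) i * fderiv ℝ S (βᵀ *ᵥ θ) (Pi.single i 1)
      = b i * S (βᵀ *ᵥ θ)) :
    ∃ c : ℝ, 0 < c ∧ βᵀ *ᵥ θ = c • wstar := by
  have hA : Function.Surjective (βᵀ *ᵥ ·) :=
    Matrix.mulVec_surjective_of_rank_eq (by rw [Matrix.rank_transpose, hrank])
  generalize βᵀ *ᵥ θ = w at hθw hFRB ⊢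
  have : Nonempty (Fin m) := ⟨⟨0, hm⟩⟩
  have hSw : 0 < S w := factorRisk_pos hR hA hS fun h =>
    (hθw (Classical.arbitrary _)).ne' (by simp [h])
  have hd : DifferentiableAt ℝ S w := by
    by_contra hd
    have := hFRB ⟨0, hm⟩
    rw [fderiv_zero_of_not_differentiableAt hd] at this
    simp [(hb _).ne', hSw.ne'] at this
  set x : Fin m → ℝ := fun i => wstar i / w i
  have hx : ∀ i, 0 < x i := fun i => div_pos (hwpos i) (hθw i)
  set T := ∑ i, b i * x i with hT
  have hTpos : 0 < T := Finset.sum_pos (fun i _ => mul_pos (hb i) (hx i)) Finset.univ_nonempty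
  have hTS : T * S w ≤ S wstar := by
    have h := fderiv_le_of_sublinear_s19 (factorRisk_add_le hR hA hS)
      (fun t ht => factorRisk_smul_le hR hA hS ht) hd wstar
    rw [pi_eq_sum_univ' wstar, map_sum, ← pi_eq_sum_univ'] at h
    refine le_trans (le_of_eq ?_) h
    rw [hT, Finset.sum_mul]
    refine Finset.sum_congr rfl fun i _ => ?_
    have hi := (hθw i).ne'
    rw [map_smul, smul_eq_mul]
    simp only [x]
    field_simp
    linear_combination -(wstar i) * hFRB i
  have hgle : g (S (T • w)) ≤ g (S wstar) :=
    hg3.monotoneOn (factorRisk_nonneg hR hS _) (factorRisk_nonneg hR hS _)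
      ((factorRisk_smul_le hR hA hS hTpos w).trans hTS)
  have hmin := hwmin (T • w) fun i => mul_pos hTpos (hθw i)
  have hlogT : ∑ i, b i * Real.log ((T • w) i) = Real.log T + ∑ i, b i * Real.log (w i) := by
    simp_rw [Pi.smul_apply, smul_eq_mul, Real.log_mul hTpos.ne' (hθw _).ne', mul_add,
      Finset.sum_add_distrib, ← Finset.sum_mul, hb1, one_mul]
  have hlogx : ∑ i, b i * Real.log (x i)
      = ∑ i, b i * Real.log (wstar i) - ∑ i, b i * Real.log (w i) := by
    simp_rw [x, Real.log_div (hwpos _).ne' (hθw _).ne', mul_sub, Finset.sum_sub_distrib]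
  have hxT := eq_of_log_sum_le_sum_log hb hb1 hx (by linarith)
  refine ⟨T⁻¹, inv_pos.mpr hTpos, funext fun i => ?_⟩
  rw [Pi.smul_apply, smul_eq_mul, hT, ← hxT i, inv_div, div_mul_cancel₀ _ (hwpos i).ne']
end
end
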